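/- (Theorem 1) For every polynomial p of degree at most 2n+1 one has ∫_a^b w(x) p(x) dx = Σ_{i=1}^{n+1} ⟨1|u_i⟩² p(x_i); that is, the quadrature rule with nodes x_1,…,x_{n+1} and weights w_i = ⟨1|u_i⟩² is exact on all polynomials of degree at most 2n+1. -/

import Mathlib

open Polynomial MeasureTheory

/-- A family of `n + 1` polynomials of degree at most `n` that is orthonormal for the form
`(f, g) ↦ L (f * g)` expands every polynomial of degree at most `n`. -/
theorem eq_sum_of_orthonormal {K : Type*} [Field K] {n : ℕ} (L : K[X] →ₗ[K] K)
    (u : Fin (n + 1) → K[X]) (hu_deg : ∀ i, (u i).natDegree ≤ n)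
    (horth : ∀ i j, L (u i * u j) = if i = j then 1 else 0)
    (q : K[X]) (hq : q.natDegree ≤ n) :
    q = ∑ i, C (L (q * u i)) * u i := by
  have hmem_degreeLT {f : K[X]} (hf : f.natDegree ≤ n) : f ∈ degreeLT K (n + 1) :=
    mem_degreeLT.2 (natDegree_le_iff_degree_le.1 hf |>.trans_lt (by exact_mod_cast n.lt_succ_self))
  have coeff_eq (c : Fin (n + 1) → K) (j) : L ((∑ i, c i • u i) * u j) = c j := by
    simp [Finset.sum_mul, horth]
  let v : Fin (n + 1) → degreeLT K (n + 1) := fun i => ⟨u i, hmem_degreeLT (hu_deg i)⟩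
  have hv : LinearIndependent K v := by
    rw [Fintype.linearIndependent_iff]
    intro c hc j
    have hsum : ∑ i, c i • u i = 0 := by
      simpa [v] using congrArg Subtype.val hc
    rw [← coeff_eq c j, hsum, zero_mul, map_zero]
  have hspan : Submodule.span K (Set.range v) = ⊤ :=
    hv.span_eq_top_of_card_eq_finrank
      (by rw [(degreeLTEquiv K (n + 1)).finrank_eq, Module.finrank_fin_fun, Fintype.card_fin])
  have hmem : (⟨q, hmem_degreeLT hq⟩ : degreeLT K (n + 1)) ∈ Submodule.span K (Set.range v) :=
    hspan ▸ Submodule.mem_top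
  obtain ⟨c, hc⟩ := (Submodule.mem_span_range_iff_exists_fun K).1 hmem
  have hsum : ∑ i, c i • u i = q := by
    simpa [v] using congrArg Subtype.val hc
  rw [← hsum]
  simp only [coeff_eq]
  simp only [smul_eq_C_mul]

/-- If moreover the family diagonalizes `(f, g) ↦ L (X * f * g)` with eigenvalues `x i`, then
multiplication by `X ^ k` acts on `u i` under `L` as the scalar `x i ^ k`, for `k ≤ n + 1`. -/
theorem map_X_pow_mul_of_orthonormal {K : Type*} [Field K] {n : ℕ} (L : K[X] →ₗ[K] K)
    (u : Fin (n + 1) → K[X]) (hu_deg : ∀ i, (u i).natDegree ≤ n) (x : Fin (n + 1) → K)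
    (horth : ∀ i j, L (u i * u j) = if i = j then 1 else 0)
    (heig : ∀ i j, L (X * u i * u j) = if i = j then x i else 0)
    (i : Fin (n + 1)) (k : ℕ) (hk : k ≤ n + 1) :
    L (X ^ k * u i) = x i ^ k * L (u i) := by
  induction k with
  | zero => simp
  | succ k ih =>
    have hexp := eq_sum_of_orthonormal L u hu_deg horth (X ^ k) (by simp; omega)
    calc L (X ^ (k + 1) * u i) = L (X * X ^ k * u i) := by rw [pow_succ']
      _ = L (∑ j, L (X ^ k * u j) • (X * u j * u i)) := by
        conv_lhs => rw [hexp]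
        simp only [Finset.mul_sum, Finset.sum_mul, smul_eq_C_mul]
        congr 1
        exact Finset.sum_congr rfl fun j _ => by ring
      _ = x i ^ (k + 1) * L (u i) := by
        simp only [map_sum, map_smul, heig, smul_eq_mul, mul_ite, mul_zero, Finset.sum_ite_eq',
          Finset.mem_univ, if_true, ih (by omega)]
        ring

/-- Gaussian quadrature for an arbitrary linear functional on polynomials. -/
theorem map_eq_sum_sq_mul_eval_of_orthonormal {K : Type*} [Field K] {n : ℕ} (L : K[X] →ₗ[K] K)
    (u : Fin (n + 1) → K[X]) (hu_deg : ∀ i, (u i).natDegree ≤ n) (x : Fin (n + 1) → K)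
    (horth : ∀ i j, L (u i * u j) = if i = j then 1 else 0)
    (heig : ∀ i j, L (X * u i * u j) = if i = j then x i else 0)
    (p : K[X]) (hp : p.natDegree ≤ 2 * n + 1) :
    L p = ∑ i, L (u i) ^ 2 * p.eval (x i) := by
  have hpow := map_X_pow_mul_of_orthonormal L u hu_deg x horth heig
  have hmon (m : ℕ) (hm : m ≤ 2 * n + 1) : L (X ^ m) = ∑ i, L (u i) ^ 2 * x i ^ m := by
    obtain ⟨j, k, hj, hk, rfl⟩ : ∃ j k, j ≤ n ∧ k ≤ n + 1 ∧ m = j + k :=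
      ⟨min m n, m - min m n, by omega, by omega, by omega⟩
    have hexp := eq_sum_of_orthonormal L u hu_deg horth (X ^ j) (by simpa using hj)
    calc L (X ^ (j + k)) = L (X ^ j * X ^ k) := by rw [pow_add]
      _ = L (∑ i, L (X ^ j * u i) • (X ^ k * u i)) := by
        conv_lhs => rw [hexp]
        simp only [Finset.sum_mul, smul_eq_C_mul]
        congr 1
        exact Finset.sum_congr rfl fun i _ => by ring
      _ = ∑ i, L (u i) ^ 2 * x i ^ (j + k) := by
        simp only [map_sum, map_smul, smul_eq_mul]
        refine Finset.sum_congr rfl fun i _ => ?_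
        rw [hpow i j (by omega), hpow i k hk]
        ring
  have hp' : p.natDegree < 2 * n + 2 := by omega
  conv_lhs => rw [p.as_sum_range' _ hp']
  simp only [eval_eq_sum_range' hp', map_sum, Finset.mul_sum]
  rw [Finset.sum_comm]
  refine Finset.sum_congr rfl fun m hm => ?_
  rw [← C_mul_X_pow_eq_monomial, ← smul_eq_C_mul, map_smul,
    hmon m (by have := Finset.mem_range.1 hm; omega), smul_eq_mul, Finset.mul_sum]
  exact Finset.sum_congr rfl fun i _ => by ring

/-- Integration against a weight that is continuous on `[a, b]`, as a linear functional on
polynomials. -/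
noncomputable def weightedIntegral (a b : ℝ) (w : ℝ → ℝ) (hw : ContinuousOn w (Set.uIcc a b)) :
    ℝ[X] →ₗ[ℝ] ℝ where
  toFun f := ∫ t in a..b, w t * f.eval t
  map_add' f g := by
    simp only [eval_add, mul_add]
    exact intervalIntegral.integral_add (hw.mul f.continuous.continuousOn).intervalIntegrable
      (hw.mul g.continuous.continuousOn).intervalIntegrable
  map_smul' c f := by
    simp only [eval_smul, smul_eq_mul, RingHom.id_apply, mul_left_comm _ c,
      intervalIntegral.integral_const_mul]

/-- **Theorem 1.** The quadrature rule with nodes `x_i` and weights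
`w_i = ⟨1|u_i⟩²` is exact on all polynomials of degree at most `2n+1`. -/
theorem gaussian_quadrature_exact
(n : ℕ) (a b : ℝ) (hab : a < b)
    (w : ℝ → ℝ) (hw_cont : ContinuousOn w (Set.Icc a b))
    (hw_pos : ∀ t ∈ Set.Ioo a b, 0 < w t)
    (u : Fin (n + 1) → Polynomial ℝ) (hu_deg : ∀ i, (u i).natDegree ≤ n)
    (x : Fin (n + 1) → ℝ)
    (horth : ∀ i j, (∫ t in a..b, w t * (u i).eval t * (u j).eval t)
      = if i = j then 1 else 0)
    (heig : ∀ i j, (∫ t in a..b, w t * t * (u i).eval t * (u j).eval t)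
      = if i = j then x i else 0)
    (p : Polynomial ℝ) (hp : p.natDegree ≤ 2 * n + 1) :
    (∫ t in a..b, w t * p.eval t)
      = ∑ i, (∫ t in a..b, w t * (u i).eval t) ^ 2 * p.eval (x i) := by
  have hw : ContinuousOn w (Set.uIcc a b) := by rwa [Set.uIcc_of_le hab.le]
  refine map_eq_sum_sq_mul_eval_of_orthonormal (weightedIntegral a b w hw) u hu_deg x
    (fun i j => ?_) (fun i j => ?_) p hp
  · simpa [weightedIntegral, mul_assoc] using horth i j
  · simpa [weightedIntegral, mul_assoc] using heig i j
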